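/- Suppose Assumption P holds and that for each ε > 0, u^ε : O* → ℝ is continuous, satisfies sup_{ε>0} sup_{O*} |u^ε| < ∞, and is both a viscosity subsolution and a viscosity supersolution of ∂_t u^ε − L^ε(D²u^ε, Du^ε, x) = 0 on O. Then the upper relaxed half-limit u* satisfies the subsolution inequality for the limit operator, i.e. a − L(X,p,x) ≤ 0 for every (x,t) ∈ O and (a,p,X) ∈ P^{2,+}u*(x,t), and the lower relaxed half-limit u_* satisfies the supersolution inequality, i.e. a − L(X,p,x) ≥ 0 for every (x,t) ∈ O and (a,p,X) ∈ P^{2,−}u_*(x,t). -/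

import Mathlib

open scoped RealInnerProductSpace Matrix
open Set

noncomputable section

abbrev Evec (n : ℕ) := EuclideanSpace ℝ (Fin n)

/-- The quadratic form `v ↦ vᵀ X v` associated to an `n × n` real matrix. -/
def quadForm {n : ℕ} (X : Matrix (Fin n) (Fin n) ℝ) (v : Evec n) : ℝ :=
  ∑ i, ∑ j, v i * X i j * v j

/-- Frobenius norm of a real matrix. -/
def frobNorm {n m : ℕ} (A : Matrix (Fin n) (Fin m) ℝ) : ℝ :=
  Real.sqrt (∑ i, ∑ j, (A i j) ^ 2)

/-- The operator `L(M, p, x) = (1/2) Tr(σ(x) σ(x)ᵀ M) + b(x) · p`. -/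
def opL {n m : ℕ} (b : Evec n → Evec n) (σ : Evec n → Matrix (Fin n) (Fin m) ℝ)
    (X : Matrix (Fin n) (Fin n) ℝ) (p x : Evec n) : ℝ :=
  (1 / 2) * Matrix.trace (σ x * (σ x)ᵀ * X) + ⟪b x, p⟫

/-- `(a, p, X)` belongs to the parabolic superjet `P^{2,+} w (x,t)` relative to the
domain `U × (0,T)`. -/
def InSuperJet {n : ℕ} (T : ℝ) (U : Set (Evec n)) (w : Evec n → ℝ → ℝ)
    (x : Evec n) (t a : ℝ) (p : Evec n) (X : Matrix (Fin n) (Fin n) ℝ) : Prop :=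
  ∀ η > (0 : ℝ), ∃ δ > (0 : ℝ), ∀ y ∈ U, ∀ s ∈ Set.Ioo (0 : ℝ) T,
    ‖y - x‖ + |s - t| < δ →
    w y s ≤ w x t + a * (s - t) + ⟪p, y - x⟫ + (1 / 2) * quadForm X (y - x)
      + η * (|s - t| + ‖y - x‖ ^ 2)

/-- `(a, p, X)` belongs to the parabolic subjet `P^{2,-} w (x,t) = -P^{2,+}(-w)(x,t)`. -/
def InSubJet {n : ℕ} (T : ℝ) (U : Set (Evec n)) (w : Evec n → ℝ → ℝ)
    (x : Evec n) (t a : ℝ) (p : Evec n) (X : Matrix (Fin n) (Fin n) ℝ) : Prop :=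
  InSuperJet T U (fun y s => -(w y s)) x t (-a) (-p) (-X)

/-- Jet inequality of a viscosity subsolution of `∂_t u - L(D²u, Du, x) = 0` on `U × (0,T)`. -/
def SubsolutionPropOn {n m : ℕ} (b : Evec n → Evec n) (σ : Evec n → Matrix (Fin n) (Fin m) ℝ)
    (T : ℝ) (U : Set (Evec n)) (u : Evec n → ℝ → ℝ) : Prop :=
  ∀ x ∈ U, ∀ t ∈ Set.Ioo (0 : ℝ) T, ∀ (a : ℝ) (p : Evec n) (X : Matrix (Fin n) (Fin n) ℝ),
    X.IsSymm → InSuperJet T U u x t a p X → a - opL b σ X p x ≤ 0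

/-- Jet inequality of a viscosity supersolution of `∂_t u - L(D²u, Du, x) = 0` on `U × (0,T)`. -/
def SupersolutionPropOn {n m : ℕ} (b : Evec n → Evec n) (σ : Evec n → Matrix (Fin n) (Fin m) ℝ)
    (T : ℝ) (U : Set (Evec n)) (u : Evec n → ℝ → ℝ) : Prop :=
  ∀ x ∈ U, ∀ t ∈ Set.Ioo (0 : ℝ) T, ∀ (a : ℝ) (p : Evec n) (X : Matrix (Fin n) (Fin n) ℝ),
    X.IsSymm → InSubJet T U u x t a p X → 0 ≤ a - opL b σ X p x

/-- The set `L_{b,σ}` of points around which `(b, σ)` is locally Lipschitz. -/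
def Lset {n m : ℕ} (b : Evec n → Evec n) (σ : Evec n → Matrix (Fin n) (Fin m) ℝ) :
    Set (Evec n) :=
  {x | ∃ U ∈ nhds x, ∃ K ≥ (0 : ℝ), ∀ y ∈ U, ∀ z ∈ U,
    ‖b y - b z‖ + frobNorm (σ y - σ z) ≤ K * ‖y - z‖}

/-- The complement `NL_{b,σ}` of `L_{b,σ}`. -/
def NLset {n m : ℕ} (b : Evec n → Evec n) (σ : Evec n → Matrix (Fin n) (Fin m) ℝ) :
    Set (Evec n) :=
  (Lset b σ)ᶜ

/-- Assumption Z on the coefficients `b`, `σ`. -/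
structure AssumptionZ {n m : ℕ} (b : Evec n → Evec n) (σ : Evec n → Matrix (Fin n) (Fin m) ℝ)
    (Cb Cσ α β : ℝ) : Prop where
  hCb : 0 < Cb
  hCσ : 0 < Cσ
  hα : α ∈ Set.Ioc (0 : ℝ) 1
  hβ : β ∈ Set.Ioc (0 : ℝ) 1
  hb_bdd : ∃ C, ∀ x, ‖b x‖ ≤ C
  hσ_bdd : ∃ C, ∀ x, frobNorm (σ x) ≤ C
  hb_hold : ∀ x y, ‖b x - b y‖ ≤ Cb * ‖x - y‖ ^ α
  hσ_hold : ∀ x y, frobNorm (σ x - σ y) ≤ Cσ * ‖x - y‖ ^ β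
  hNL : ∀ x ∈ NLset b σ, b x = 0 ∧ σ x = 0 ∧ ∃ r > (0 : ℝ),
    ∀ y ∈ Metric.ball x r ∩ Lset b σ, ∀ v : Evec n,
      Cσ⁻¹ * ‖x - y‖ ^ (2 * β) * ‖v‖ ^ 2 ≤ quadForm (σ y * (σ y)ᵀ) v ∧
      quadForm (σ y * (σ y)ᵀ) v ≤ Cσ * ‖x - y‖ ^ (2 * β) * ‖v‖ ^ 2
  hexp : 1 + α - 2 * β > 0
  hβ_half : β > 1 / 2

/-- Assumption P on the approximating coefficients `bε`, `σε`. -/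
structure AssumptionP {n m : ℕ} (b : Evec n → Evec n) (σ : Evec n → Matrix (Fin n) (Fin m) ℝ)
    (bε : ℝ → Evec n → Evec n) (σε : ℝ → Evec n → Matrix (Fin n) (Fin m) ℝ) : Prop where
  hb_cont : Continuous b
  hσ_cont : ∀ i j, Continuous fun x => σ x i j
  hb_bdd : ∃ C, ∀ x, ‖b x‖ ≤ C
  hσ_bdd : ∃ C, ∀ x, frobNorm (σ x) ≤ C
  hbε_cont : ∀ ε > (0 : ℝ), Continuous (bε ε)
  hσε_cont : ∀ ε > (0 : ℝ), ∀ i j, Continuous fun x => σε ε x i j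
  hbε_bdd : ∀ ε > (0 : ℝ), ∃ C, ∀ x, ‖bε ε x‖ ≤ C
  hσε_bdd : ∀ ε > (0 : ℝ), ∃ C, ∀ x, frobNorm (σε ε x) ≤ C
  hposdef : ∀ ε > (0 : ℝ), ∀ x, (σε ε x * (σε ε x)ᵀ).PosDef
  hconv_b : ∀ K : Set (Evec n), IsCompact K → ∀ η > (0 : ℝ), ∃ ε₀ > (0 : ℝ),
    ∀ ε, 0 < ε → ε < ε₀ → ∀ x ∈ K, ‖bε ε x - b x‖ < η
  hconv_σ : ∀ K : Set (Evec n), IsCompact K → ∀ η > (0 : ℝ), ∃ ε₀ > (0 : ℝ),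
    ∀ ε, 0 < ε → ε < ε₀ → ∀ x ∈ K, frobNorm (σε ε x - σ x) < η

/-- The upper relaxed half-limit `u*` of a family `(u^ε)_{ε>0}` on `ℝ^n × [0,T)`. -/
def relaxSup {n : ℕ} (T : ℝ) (u : ℝ → Evec n → ℝ → ℝ) (x : Evec n) (t : ℝ) : ℝ :=
  ⨅ δ : {d : ℝ // 0 < d}, sSup {r : ℝ | ∃ ε, 0 < ε ∧ ε < δ.1 ∧ ∃ y : Evec n, ∃ s : ℝ,
    0 ≤ s ∧ s < T ∧ ‖x - y‖ + |t - s| < δ.1 ∧ u ε y s = r}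

/-- The lower relaxed half-limit `u_*` of a family `(u^ε)_{ε>0}` on `ℝ^n × [0,T)`. -/
def relaxInf {n : ℕ} (T : ℝ) (u : ℝ → Evec n → ℝ → ℝ) (x : Evec n) (t : ℝ) : ℝ :=
  ⨆ δ : {d : ℝ // 0 < d}, sInf {r : ℝ | ∃ ε, 0 < ε ∧ ε < δ.1 ∧ ∃ y : Evec n, ∃ s : ℝ,
    0 ≤ s ∧ s < T ∧ ‖x - y‖ + |t - s| < δ.1 ∧ u ε y s = r}


theorem quadForm_eq_inner {n : ℕ} (X : Matrix (Fin n) (Fin n) ℝ) (v : Evec n) :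
    quadForm X v = ⟪Matrix.toEuclideanLin X v, v⟫ := by
  simp only [quadForm, PiLp.inner_apply, Matrix.toLpLin_apply, Matrix.mulVec, dotProduct,
    RCLike.inner_apply, conj_trivial, Finset.mul_sum]
  exact Finset.sum_congr rfl fun i _ => Finset.sum_congr rfl fun j _ => by ring

theorem continuous_quadForm {n : ℕ} (X : Matrix (Fin n) (Fin n) ℝ) :
    Continuous (quadForm X) := by
  unfold quadForm
  fun_prop

/-- Exact second order expansion of a quadratic form. -/
theorem quadForm_add {n : ℕ} {X : Matrix (Fin n) (Fin n) ℝ} (hX : X.IsSymm) (v h : Evec n) :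
    quadForm X (v + h) =
      quadForm X v + 2 * ⟪Matrix.toEuclideanLin X v, h⟫ + quadForm X h := by
  have hsymm : ⟪Matrix.toEuclideanLin X h, v⟫ = ⟪Matrix.toEuclideanLin X v, h⟫ := by
    have hself : (Matrix.toEuclideanLin X).IsSymmetric :=
      Matrix.isSymmetric_toEuclideanLin_iff.2 (by
        rw [Matrix.IsHermitian, Matrix.conjTranspose_eq_transpose_of_trivial]; exact hX)
    rw [hself h v, real_inner_comm]
  simp only [quadForm_eq_inner, map_add, inner_add_left, inner_add_right, hsymm]
  ring

theorem quadForm_add_smul_one {n : ℕ} (X : Matrix (Fin n) (Fin n) ℝ) (c : ℝ) (v : Evec n) :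
    quadForm (X + c • 1) v = quadForm X v + c * ‖v‖ ^ 2 := by
  have hone : Matrix.toEuclideanLin (1 : Matrix (Fin n) (Fin n) ℝ) v = v := by
    simp
  simp only [quadForm_eq_inner, map_add, map_smul, LinearMap.add_apply, LinearMap.smul_apply,
    inner_add_left, real_inner_smul_left, hone, real_inner_self_eq_norm_sq]

theorem abs_entry_le_frobNorm {n m : ℕ} (A : Matrix (Fin n) (Fin m) ℝ) (i : Fin n) (j : Fin m) :
    |A i j| ≤ frobNorm A := by
  refine Real.abs_le_sqrt ?_
  calc (A i j) ^ 2 ≤ ∑ j, (A i j) ^ 2 :=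
        Finset.single_le_sum (f := fun j => (A i j) ^ 2) (fun _ _ => sq_nonneg _)
          (Finset.mem_univ j)
    _ ≤ ∑ i, ∑ j, (A i j) ^ 2 :=
        Finset.single_le_sum (f := fun i => ∑ j, (A i j) ^ 2)
          (fun _ _ => Finset.sum_nonneg fun _ _ => sq_nonneg _) (Finset.mem_univ i)

theorem opL_neg {n m : ℕ} (b : Evec n → Evec n) (σ : Evec n → Matrix (Fin n) (Fin m) ℝ)
    (X : Matrix (Fin n) (Fin n) ℝ) (p x : Evec n) :
    opL b σ (-X) (-p) x = -opL b σ X p x := by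
  simp only [opL, Matrix.mul_neg, Matrix.trace_neg, inner_neg_right]
  ring

/-- A bound above the upper relaxed half-limit holds for the family near the point. -/
theorem exists_forall_lt_of_relaxSup_lt {n : ℕ} {T : ℝ} {u : ℝ → Evec n → ℝ → ℝ}
    {C : ℝ} (hC : ∀ ε > (0 : ℝ), ∀ (x : Evec n) (t : ℝ), 0 ≤ t → t < T → |u ε x t| ≤ C)
    {x : Evec n} {t c : ℝ} (h : relaxSup T u x t < c) :
    ∃ δ > (0 : ℝ), ∀ ε, 0 < ε → ε < δ → ∀ (y : Evec n) (s : ℝ), 0 ≤ s → s < T →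
      ‖x - y‖ + |t - s| < δ → u ε y s < c := by
  have : Nonempty {d : ℝ // 0 < d} := ⟨⟨1, one_pos⟩⟩
  obtain ⟨δ, hδ⟩ := exists_lt_of_ciInf_lt h
  refine ⟨δ.1, δ.2, fun ε h0 h1 y s hs0 hs1 hd => lt_of_le_of_lt (le_csSup ?_ ?_) hδ⟩
  · refine ⟨C, ?_⟩
    rintro r ⟨ε, h0, -, y, s, hs0, hs1, -, rfl⟩
    exact (abs_le.1 (hC ε h0 y s hs0 hs1)).2
  · exact ⟨ε, h0, h1, y, s, hs0, hs1, hd, rfl⟩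

/-- A bound below the upper relaxed half-limit is exceeded by the family near the point. -/
theorem exists_lt_of_lt_relaxSup {n : ℕ} {T : ℝ} {u : ℝ → Evec n → ℝ → ℝ}
    {C : ℝ} (hC : ∀ ε > (0 : ℝ), ∀ (x : Evec n) (t : ℝ), 0 ≤ t → t < T → |u ε x t| ≤ C)
    {x : Evec n} {t c : ℝ} (ht0 : 0 ≤ t) (htT : t < T) (h : c < relaxSup T u x t)
    {δ : ℝ} (hδ : 0 < δ) :
    ∃ ε, 0 < ε ∧ ε < δ ∧ ∃ (y : Evec n) (s : ℝ), ‖x - y‖ + |t - s| < δ ∧ c < u ε y s := by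
  have hmem : ∀ d : {d : ℝ // 0 < d}, u (d.1 / 2) x t ∈ {r : ℝ | ∃ ε, 0 < ε ∧ ε < d.1 ∧
      ∃ y : Evec n, ∃ s : ℝ, 0 ≤ s ∧ s < T ∧ ‖x - y‖ + |t - s| < d.1 ∧ u ε y s = r} :=
    fun d => ⟨d.1 / 2, half_pos d.2, half_lt_self d.2, x, t, ht0, htT, by simpa using d.2, rfl⟩
  have hle := h.trans_le (ciInf_le ⟨-C, ?_⟩ (⟨δ, hδ⟩ : {d : ℝ // 0 < d}))
  · obtain ⟨r, ⟨ε, h0, h1, y, s, -, -, hd, rfl⟩, hr⟩ :=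
      exists_lt_of_lt_csSup ⟨_, hmem ⟨δ, hδ⟩⟩ hle
    exact ⟨ε, h0, h1, y, s, hd, hr⟩
  · rintro _ ⟨d, rfl⟩
    refine le_trans (abs_le.1 (hC (d.1 / 2) (half_pos d.2) x t ht0 htT)).1
      (le_csSup ⟨C, ?_⟩ (hmem d))
    rintro r ⟨ε, h0, -, y, s, hs0, hs1, -, rfl⟩
    exact (abs_le.1 (hC ε h0 y s hs0 hs1)).2

theorem relaxSup_neg {n : ℕ} (T : ℝ) (u : ℝ → Evec n → ℝ → ℝ) (x : Evec n) (t : ℝ) :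
    relaxSup T (fun ε y s => -u ε y s) x t = -relaxInf T u x t := by
  unfold relaxSup relaxInf
  rw [iSup, iInf, Real.sInf_def, ← Set.image_neg_eq_neg, ← Set.range_comp]
  congr 3
  funext δ
  simp only [Function.comp, Real.sInf_def]
  congr 2
  ext r
  simp [neg_eq_iff_eq_neg]

/-- A function touched from above at an interior point by a quadratic polynomial in space plus a
function differentiable in time has the derivatives of the latter as a superjet. -/
theorem inSuperJet_of_isMaxOn {n : ℕ} {T : ℝ} {w : Evec n → ℝ → ℝ} {x p y₀ : Evec n}
    {X : Matrix (Fin n) (Fin n) ℝ} (hX : X.IsSymm) {g : ℝ → ℝ} {g' s₀ : ℝ}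
    (hg : HasDerivAt g g' s₀) {K : Set (Evec n × ℝ)} (hK : K ∈ nhds (y₀, s₀))
    (hmax : IsMaxOn (fun z : Evec n × ℝ =>
      w z.1 z.2 - (g z.2 + ⟪p, z.1 - x⟫ + (1 / 2) * quadForm X (z.1 - x))) K (y₀, s₀)) :
    InSuperJet T Set.univ w y₀ s₀ g' (p + Matrix.toEuclideanLin X (y₀ - x)) X := by
  intro η hη
  obtain ⟨δ₁, hδ₁, hball⟩ := Metric.mem_nhds_iff.1 hK
  obtain ⟨δ₂, hδ₂, hsmall⟩ := Metric.eventually_nhds_iff.1 (hg.isLittleO.def hη)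
  refine ⟨min δ₁ δ₂, lt_min hδ₁ hδ₂, fun y _ s _ hd => ?_⟩
  have hy : ‖y - y₀‖ < min δ₁ δ₂ := lt_of_le_of_lt (by linarith [abs_nonneg (s - s₀)]) hd
  have hs : |s - s₀| < min δ₁ δ₂ := lt_of_le_of_lt (by linarith [norm_nonneg (y - y₀)]) hd
  have hin : (y, s) ∈ K := by
    refine hball ?_
    rw [Metric.mem_ball, Prod.dist_eq, max_lt_iff, dist_eq_norm, Real.dist_eq]
    exact ⟨hy.trans_le (min_le_left _ _), hs.trans_le (min_le_left _ _)⟩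
  have hm := hmax hin
  simp only [Set.mem_ofPred_eq] at hm
  have hgs := hsmall (y := s) (by rw [Real.dist_eq]; exact hs.trans_le (min_le_right _ _))
  rw [Real.norm_eq_abs, Real.norm_eq_abs, smul_eq_mul] at hgs
  have hgs' := (abs_le.1 hgs).2
  have hyx : y - x = (y₀ - x) + (y - y₀) := by abel
  rw [hyx, quadForm_add hX, inner_add_right] at hm
  rw [inner_add_left]
  nlinarith [mul_nonneg hη.le (sq_nonneg ‖y - y₀‖)]

/-- Derivative of the smoothed absolute value, together with its bound. -/
theorem exists_hasDerivAt_sqrt_sq_add {κ : ℝ} (hκ : 0 < κ) (t s : ℝ) :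
    ∃ d, |d| ≤ 1 ∧ HasDerivAt (fun r => √((r - t) ^ 2 + κ ^ 2)) d s := by
  have hpos : 0 < (s - t) ^ 2 + κ ^ 2 := by positivity
  have hsq : HasDerivAt (fun r => (r - t) ^ 2 + κ ^ 2) (2 * (s - t)) s := by
    simpa using (((hasDerivAt_id s).sub_const t).pow 2).add_const (κ ^ 2)
  refine ⟨_, ?_, hsq.sqrt hpos.ne'⟩
  rw [mul_div_mul_left _ _ two_ne_zero, abs_div, abs_of_nonneg (Real.sqrt_nonneg _)]
  exact div_le_one_of_le₀ (Real.abs_le_sqrt (by nlinarith [sq_nonneg κ])) (Real.sqrt_nonneg _)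

/-- Superjets of the upper relaxed half-limit are approximated by points where the perturbed
subsolution inequality holds. -/
theorem exists_perturbed_inequality {n m : ℕ} {T : ℝ}
    {bε : ℝ → Evec n → Evec n} {σε : ℝ → Evec n → Matrix (Fin n) (Fin m) ℝ}
    {u : ℝ → Evec n → ℝ → ℝ}
    (hcont : ∀ ε > (0 : ℝ), ContinuousOn (Function.uncurry (u ε)) (Set.univ ×ˢ Set.Ico 0 T))
    {C : ℝ} (hC : ∀ ε > (0 : ℝ), ∀ (x : Evec n) (t : ℝ), 0 ≤ t → t < T → |u ε x t| ≤ C)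
    (hsub : ∀ ε > (0 : ℝ), SubsolutionPropOn (bε ε) (σε ε) T Set.univ (u ε))
    {x : Evec n} {t : ℝ} (ht : t ∈ Set.Ioo (0 : ℝ) T) {a : ℝ} {p : Evec n}
    {X : Matrix (Fin n) (Fin n) ℝ} (hX : X.IsSymm)
    (hjet : InSuperJet T Set.univ (relaxSup T u) x t a p X) {ρ : ℝ} (hρ : 0 < ρ) :
    ∃ ε, 0 < ε ∧ ε < ρ ∧ ∃ y : Evec n, ‖y - x‖ < ρ ∧ ∃ a' : ℝ, |a' - a| ≤ 2 * ρ ∧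
      a' - opL (bε ε) (σε ε) (X + (4 * ρ) • 1)
        (p + Matrix.toEuclideanLin (X + (4 * ρ) • 1) (y - x)) y ≤ 0 := by
  obtain ⟨ht0, htT⟩ := ht
  obtain ⟨δ, hδ, hjet⟩ := hjet ρ hρ
  obtain ⟨r, hr, hrm⟩ : ∃ r > 0, r < min (min 1 ρ) (min (δ / 2) (min t (T - t))) :=
    exists_between (by simp only [lt_min_iff]; refine ⟨⟨?_, ?_⟩, ?_, ?_, ?_⟩ <;> linarith)
  simp only [lt_min_iff] at hrm
  obtain ⟨⟨hr1, hrρ⟩, hrδ, hrt, hrT⟩ := hrm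
  set Y := X + (4 * ρ) • (1 : Matrix (Fin n) (Fin n) ℝ) with hYdef
  have hY : Y.IsSymm := hX.add ((Matrix.isSymm_one).smul _)
  set κ := r ^ 2 / 8 with hκdef
  have hκ : 0 < κ := by positivity
  set g : ℝ → ℝ := fun s => a * (s - t) + 2 * ρ * √((s - t) ^ 2 + κ ^ 2) with hgdef
  set φ : Evec n × ℝ → ℝ := fun z => g z.2 + ⟪p, z.1 - x⟫ + (1 / 2) * quadForm Y (z.1 - x)
    with hφdef
  have hφc : Continuous φ := by
    have := continuous_quadForm Y
    simp only [hφdef, hgdef]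
    fun_prop
  set w := relaxSup T u with hw
  set K : Set (Evec n × ℝ) := Metric.closedBall x r ×ˢ Set.Icc (t - r) (t + r) with hKdef
  set S : Set (Evec n × ℝ) := Metric.ball x r ×ˢ Set.Ioo (t - r) (t + r) with hSdef
  have hSo : IsOpen S := Metric.isOpen_ball.prod isOpen_Ioo
  have hSK : S ⊆ K := Set.prod_mono Metric.ball_subset_closedBall Set.Ioo_subset_Icc_self
  have hKc : IsCompact K := (isCompact_closedBall x r).prod isCompact_Icc
  have hboundary : ∀ z ∈ K \ S, w z.1 z.2 < w x t + φ z - ρ * r ^ 2 / 2 := by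
    rintro ⟨y, s⟩ ⟨⟨hy, hs⟩, hnS⟩
    rw [mem_closedBall_iff_norm] at hy
    have hs' : |s - t| ≤ r := abs_le.2 ⟨by linarith [hs.1], by linarith [hs.2]⟩
    have hj := hjet y (Set.mem_univ _) s ⟨by linarith [hs.1], by linarith [hs.2]⟩ (by linarith)
    have hfar : r ^ 2 ≤ |s - t| + ‖y - x‖ ^ 2 := by
      by_cases hyr : ‖y - x‖ < r
      · have : r ≤ |s - t| := by
          by_contra hlt
          have := abs_lt.1 (not_le.1 hlt)
          exact hnS ⟨mem_ball_iff_norm.2 hyr, by linarith, by linarith⟩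
        nlinarith [sq_nonneg ‖y - x‖]
      · nlinarith [abs_nonneg (s - t), not_lt.1 hyr]
    have hroot : |s - t| ≤ √((s - t) ^ 2 + κ ^ 2) :=
      Real.abs_le_sqrt (by nlinarith [sq_nonneg κ])
    simp only [hφdef, hgdef, hYdef, quadForm_add_smul_one]
    nlinarith [mul_le_mul_of_nonneg_left hfar hρ.le, mul_le_mul_of_nonneg_left hroot hρ.le,
      mul_pos hρ (sq_pos_of_pos hr)]
  have huniform : ∀ᶠ ε in nhds (0 : ℝ), ∀ z ∈ K \ S,
      0 < ε → u ε z.1 z.2 < w x t + φ z - ρ * r ^ 2 / 2 := by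
    refine (hKc.diff hSo).eventually_forall_of_forall_eventually ?_
    rintro ⟨y, s⟩ hz
    obtain ⟨c, hc1, hc2⟩ := exists_between (hboundary _ hz)
    obtain ⟨d, hd, hlt⟩ := exists_forall_lt_of_relaxSup_lt hC hc1
    have hs : s ∈ Set.Ioo 0 T := ⟨by linarith [hz.1.2.1], by linarith [hz.1.2.2]⟩
    have hcont1 : Continuous fun q : ℝ × (Evec n × ℝ) => w x t + φ q.2 - ρ * r ^ 2 / 2 := by
      fun_prop
    have hcont2 : Continuous fun q : ℝ × (Evec n × ℝ) => ‖y - q.2.1‖ + |s - q.2.2| := by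
      fun_prop
    have hd0 : ‖y - y‖ + |s - s| < d := by simpa using hd
    have hcont3 : Continuous fun q : ℝ × (Evec n × ℝ) => q.2.2 := by fun_prop
    filter_upwards [(hcont1.tendsto (0, (y, s))).eventually (lt_mem_nhds hc2),
      (hcont2.tendsto (0, (y, s))).eventually (gt_mem_nhds hd0),
      (continuous_fst.tendsto ((0 : ℝ), (y, s))).eventually (gt_mem_nhds hd),
      (hcont3.tendsto (0, (y, s))).eventually (isOpen_Ioo.mem_nhds hs)] with q h1 h2 h3 h4 h5
    exact (hlt q.1 h5 h3 q.2.1 q.2.2 h4.1.le h4.2 h2).trans h1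
  obtain ⟨ε₁, hε₁, hunif⟩ := Metric.eventually_nhds_iff.1 huniform
  have hcenter : w x t + φ (x, t) - ρ * r ^ 2 / 2 < w x t := by
    have hφ0 : φ (x, t) = 2 * ρ * κ := by
      simp [hφdef, hgdef, quadForm, Real.sqrt_sq hκ.le]
    rw [hφ0, hκdef]
    nlinarith [mul_pos hρ (sq_pos_of_pos hr)]
  obtain ⟨c, hc1, hc2⟩ := exists_between hcenter
  have hnear : ∀ᶠ z in nhds (x, t), w x t + φ z - ρ * r ^ 2 / 2 < c :=
    ((by fun_prop : Continuous fun z => w x t + φ z - ρ * r ^ 2 / 2).tendsto (x, t)).eventually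
      (gt_mem_nhds hc1)
  have hxS : (x, t) ∈ S := ⟨Metric.mem_ball_self hr, by linarith, by linarith⟩
  obtain ⟨δ', hδ', hnear⟩ := Metric.eventually_nhds_iff.1 (hnear.and (hSo.mem_nhds hxS))
  obtain ⟨ε, hε, hεlt, y₁, s₁, hd, hbig⟩ := exists_lt_of_lt_relaxSup hC ht0.le htT hc2
    (lt_min (lt_min hδ' hε₁) hρ)
  simp only [lt_min_iff] at hεlt hd
  obtain ⟨hlow, hmemS⟩ := hnear (y := (y₁, s₁)) (by
    rw [dist_comm, Prod.dist_eq, max_lt_iff, dist_eq_norm, Real.dist_eq]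
    exact ⟨by linarith [abs_nonneg (t - s₁)], by linarith [norm_nonneg (x - y₁)]⟩)
  have hucont : ContinuousOn (fun z : Evec n × ℝ => u ε z.1 z.2 - φ z) K := by
    refine ContinuousOn.sub ((hcont ε hε).mono ?_) hφc.continuousOn
    rintro ⟨y, s⟩ ⟨-, hs⟩
    exact ⟨Set.mem_univ _, by linarith [hs.1], by linarith [hs.2]⟩
  obtain ⟨⟨y₀, s₀⟩, h0S, hmax⟩ := hKc.exists_isMaxOn_mem_subset (s := S) hucont (hSK hmemS)
    (by
      intro z hz
      have := hunif (y := ε) (by simpa [abs_of_pos hε] using hεlt.1.2) z hz hε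
      simp only
      linarith)
  obtain ⟨d, hd1, hder⟩ := exists_hasDerivAt_sqrt_sq_add hκ t s₀
  have hg : HasDerivAt g (a + 2 * ρ * d) s₀ := by
    have hlin : HasDerivAt (fun s => a * (s - t)) a s₀ := by
      simpa using ((hasDerivAt_id s₀).sub_const t).const_mul a
    exact hlin.add (hder.const_mul (2 * ρ))
  refine ⟨ε, hε, hεlt.2, y₀, (mem_ball_iff_norm.1 h0S.1).trans hrρ, a + 2 * ρ * d, ?_, ?_⟩
  · rw [add_sub_cancel_left, abs_mul, abs_of_pos (by positivity : 0 < 2 * ρ)]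
    exact mul_le_of_le_one_right (by positivity) hd1
  · refine hsub ε hε y₀ (Set.mem_univ _) s₀
      ⟨by linarith [h0S.2.1], by linarith [h0S.2.2]⟩ _ _ _ hY ?_
    exact inSuperJet_of_isMaxOn hY hg
      (Filter.mem_of_superset (hSo.mem_nhds h0S) hSK) hmax

/-- Uniform convergence on compact sets passes to the values along convergent points. -/
theorem tendsto_apply_of_uniform_on_compacts {n : ℕ} {β : Type*} [PseudoMetricSpace β]
    {F : ℝ → Evec n → β} {f : Evec n → β} (hf : Continuous f)
    (hF : ∀ K : Set (Evec n), IsCompact K → ∀ η > (0 : ℝ), ∃ ε₀ > (0 : ℝ),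
      ∀ ε, 0 < ε → ε < ε₀ → ∀ x ∈ K, dist (F ε x) (f x) < η)
    {ε : ℕ → ℝ} (hpos : ∀ k, 0 < ε k) (hε : Filter.Tendsto ε Filter.atTop (nhds 0))
    {y : ℕ → Evec n} {x : Evec n} (hy : Filter.Tendsto y Filter.atTop (nhds x)) :
    Filter.Tendsto (fun k => F (ε k) (y k)) Filter.atTop (nhds (f x)) := by
  refine tendsto_comp_of_locally_uniform_limit (F := fun k => F (ε k)) hf.continuousAt hy ?_
  intro V hV
  obtain ⟨η, hη, hηV⟩ := Metric.mem_uniformity_dist.1 hV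
  obtain ⟨ε₀, hε₀, hclose⟩ := hF (Metric.closedBall x 1) (isCompact_closedBall x 1) η hη
  refine ⟨_, Metric.closedBall_mem_nhds x one_pos, ?_⟩
  filter_upwards [hε.eventually (gt_mem_nhds hε₀)] with k hk z hz
  exact hηV (by rw [dist_comm]; exact hclose _ (hpos k) hk z hz)

theorem subsolutionPropOn_relaxSup {n m : ℕ} {T : ℝ}
    {b : Evec n → Evec n} {σ : Evec n → Matrix (Fin n) (Fin m) ℝ}
    {bε : ℝ → Evec n → Evec n} {σε : ℝ → Evec n → Matrix (Fin n) (Fin m) ℝ}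
    (hP : AssumptionP b σ bε σε) {u : ℝ → Evec n → ℝ → ℝ}
    (hcont : ∀ ε > (0 : ℝ), ContinuousOn (Function.uncurry (u ε)) (Set.univ ×ˢ Set.Ico 0 T))
    {C : ℝ} (hC : ∀ ε > (0 : ℝ), ∀ (x : Evec n) (t : ℝ), 0 ≤ t → t < T → |u ε x t| ≤ C)
    (hsub : ∀ ε > (0 : ℝ), SubsolutionPropOn (bε ε) (σε ε) T Set.univ (u ε)) :
    SubsolutionPropOn b σ T Set.univ (relaxSup T u) := by
  intro x _ t ht a p X hX hjet
  have hρ : ∀ k : ℕ, 0 < 1 / ((k : ℝ) + 1) := fun k => Nat.one_div_pos_of_nat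
  have hρ0 : Filter.Tendsto (fun k : ℕ => 1 / ((k : ℝ) + 1)) Filter.atTop (nhds 0) :=
    tendsto_one_div_add_atTop_nhds_zero_nat
  choose ε hεpos hεlt y hy a' ha' hineq using fun k : ℕ =>
    exists_perturbed_inequality hcont hC hsub ht hX hjet (hρ k)
  have hε : Filter.Tendsto ε Filter.atTop (nhds 0) :=
    squeeze_zero (fun k => (hεpos k).le) (fun k => (hεlt k).le) hρ0
  have hyx : Filter.Tendsto y Filter.atTop (nhds x) :=
    tendsto_iff_norm_sub_tendsto_zero.2
      (squeeze_zero (fun _ => norm_nonneg _) (fun k => (hy k).le) hρ0)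
  have ha : Filter.Tendsto a' Filter.atTop (nhds a) :=
    tendsto_iff_norm_sub_tendsto_zero.2
      (squeeze_zero (fun _ => norm_nonneg _) ha' (by simpa using hρ0.const_mul 2))
  have hb : Filter.Tendsto (fun k => bε (ε k) (y k)) Filter.atTop (nhds (b x)) :=
    tendsto_apply_of_uniform_on_compacts hP.hb_cont
      (by simpa only [dist_eq_norm] using hP.hconv_b) hεpos hε hyx
  have hσ : Filter.Tendsto (fun k => σε (ε k) (y k)) Filter.atTop (nhds (σ x)) := by
    refine tendsto_pi_nhds.2 fun i => tendsto_pi_nhds.2 fun j => ?_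
    refine tendsto_apply_of_uniform_on_compacts (F := fun e z => σε e z i j)
      (f := fun z => σ z i j) (hP.hσ_cont i j) ?_ hεpos hε hyx
    intro K hK η hη
    obtain ⟨ε₀, hε₀, hclose⟩ := hP.hconv_σ K hK η hη
    refine ⟨ε₀, hε₀, fun e h0 h1 z hz => lt_of_le_of_lt ?_ (hclose e h0 h1 z hz)⟩
    simpa [Real.dist_eq] using abs_entry_le_frobNorm (σε e z - σ z) i j
  have hY : Filter.Tendsto (fun k : ℕ => X + (4 * (1 / ((k : ℝ) + 1))) •
      (1 : Matrix (Fin n) (Fin n) ℝ)) Filter.atTop (nhds X) := by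
    simpa using tendsto_const_nhds.add ((hρ0.const_mul 4).smul_const
      (1 : Matrix (Fin n) (Fin n) ℝ))
  have hp : Filter.Tendsto (fun k : ℕ => p + Matrix.toEuclideanLin
      (X + (4 * (1 / ((k : ℝ) + 1))) • (1 : Matrix (Fin n) (Fin n) ℝ)) (y k - x))
      Filter.atTop (nhds p) := by
    have hdiff : Filter.Tendsto (fun k => y k - x) Filter.atTop (nhds 0) := by
      simpa using hyx.sub_const x
    have hlin : Filter.Tendsto (fun k => Matrix.toEuclideanLin X (y k - x))
        Filter.atTop (nhds 0) := by
      rw [← map_zero (Matrix.toEuclideanLin X)]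
      exact ((Matrix.toEuclideanLin X).continuous_of_finiteDimensional.tendsto 0).comp hdiff
    have hone : ∀ v : Evec n, Matrix.toEuclideanLin (1 : Matrix (Fin n) (Fin n) ℝ) v = v :=
      fun v => by simp
    simp only [map_add, map_smul, LinearMap.add_apply, LinearMap.smul_apply, hone]
    simpa using tendsto_const_nhds.add (hlin.add ((hρ0.const_mul 4).smul hdiff))
  have hL : Filter.Tendsto (fun k : ℕ => a' k - opL (bε (ε k)) (σε (ε k))
      (X + (4 * (1 / ((k : ℝ) + 1))) • 1) (p + Matrix.toEuclideanLin
        (X + (4 * (1 / ((k : ℝ) + 1))) • 1) (y k - x)) (y k))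
      Filter.atTop (nhds (a - opL b σ X p x)) := by
    have htrace : Continuous fun q : Matrix (Fin n) (Fin m) ℝ × Matrix (Fin n) (Fin n) ℝ =>
        Matrix.trace (q.1 * q.1ᵀ * q.2) :=
      ((continuous_fst.matrix_mul continuous_fst.matrix_transpose).matrix_mul
        continuous_snd).matrix_trace
    exact ha.sub ((((htrace.tendsto (σ x, X)).comp (hσ.prodMk_nhds hY)).const_mul (1 / 2)).add
      (hb.inner hp))
  exact le_of_tendsto' hL hineq

/-- the relaxed half-limits of viscosity solutions of the perturbed equations
satisfy the sub/supersolution inequalities for the limit operator. -/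
theorem relaxed_halfLimits_are_subsupersolutions {n m : ℕ} (T : ℝ) (hT : 0 < T)
    (b : Evec n → Evec n) (σ : Evec n → Matrix (Fin n) (Fin m) ℝ)
    (bε : ℝ → Evec n → Evec n) (σε : ℝ → Evec n → Matrix (Fin n) (Fin m) ℝ)
    (hP : AssumptionP b σ bε σε)
    (u : ℝ → Evec n → ℝ → ℝ)
    (hcont : ∀ ε > (0 : ℝ), ContinuousOn (Function.uncurry (u ε)) (Set.univ ×ˢ Set.Ico 0 T))
    (hbdd : ∃ C, ∀ ε > (0 : ℝ), ∀ (x : Evec n) (t : ℝ), 0 ≤ t → t < T → |u ε x t| ≤ C)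
    (hsub : ∀ ε > (0 : ℝ), SubsolutionPropOn (bε ε) (σε ε) T Set.univ (u ε))
    (hsuper : ∀ ε > (0 : ℝ), SupersolutionPropOn (bε ε) (σε ε) T Set.univ (u ε)) :
    SubsolutionPropOn b σ T Set.univ (relaxSup T u) ∧
    SupersolutionPropOn b σ T Set.univ (relaxInf T u) := by
  obtain ⟨C, hC⟩ := hbdd
  refine ⟨subsolutionPropOn_relaxSup hP hcont hC hsub, ?_⟩
  have hneg : SubsolutionPropOn b σ T Set.univ (relaxSup T fun ε y s => -u ε y s) := by
    refine subsolutionPropOn_relaxSup hP (fun ε hε => (hcont ε hε).neg)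
      (fun ε hε x t h0 h1 => by rw [abs_neg]; exact hC ε hε x t h0 h1) ?_
    intro ε hε x hx t ht a p X hX hjet
    have h := hsuper ε hε x hx t ht (-a) (-p) (-X) hX.neg
      (by simpa only [InSubJet, neg_neg] using hjet)
    rw [opL_neg] at h
    linarith
  intro x hx t ht a p X hX hjet
  have h := hneg x hx t ht (-a) (-p) (-X) hX.neg (by
    have hfun : (relaxSup T fun ε y s => -u ε y s) = fun y s => -relaxInf T u y s :=
      funext fun y => funext fun s => relaxSup_neg T u y s
    rw [hfun]
    exact hjet)
  rw [opL_neg] at h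
  linarith

end
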